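/- arXiv:2303.13144 — 6 statements merged into one kernel-verified Lean document; each statement's English description precedes it below -/
import Mathlib

section
/- Let X be a topological space and H : X → M_n(ℂ) a continuous map such that H(x) is a Hermitian involution for every x ∈ X. Consider the block-diagonal family G(x) = [[H(x), 0], [0, −H(x)]] ∈ M_{2n}(ℂ). Then there exists a continuous map F : X × [0,1] → M_{2n}(ℂ) such that F(x,0) = G(x) for all x, F(x,t) is a Hermitian involution for all (x,t), and F(x,1) is a constant map (independent of x) whose value is a diagonal matrix all of whose diagonal entries are 1 or −1. -/
/-- The Hermitian block matrix `[[a H + c, i b], [-i b, -(a H + c)]]` with real `a`, `b`, `c`. -/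
noncomputable def blockDeformation {m : Type*} [DecidableEq m]
    (H : Matrix m m ℂ) (a b c : ℝ) : Matrix (m ⊕ m) (m ⊕ m) ℂ :=
  Matrix.fromBlocks ((a : ℂ) • H + (c : ℂ) • 1) ((Complex.I * b) • 1)
    (-((Complex.I * b) • 1)) (-((a : ℂ) • H + (c : ℂ) • 1))

theorem blockDeformation_isHermitian {m : Type*} [DecidableEq m]
    {H : Matrix m m ℂ} (hH : H.IsHermitian) (a b c : ℝ) :
    (blockDeformation H a b c).IsHermitian := by
  have hdiag : ((a : ℂ) • H + (c : ℂ) • (1 : Matrix m m ℂ)).IsHermitian := by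
    simp [Matrix.IsHermitian, Matrix.conjTranspose_smul, hH.eq]
  refine Matrix.IsHermitian.fromBlocks hdiag ?_ hdiag.neg
  simp [Matrix.conjTranspose_smul]

theorem blockDeformation_sq {m : Type*} [Fintype m] [DecidableEq m]
    {H : Matrix m m ℂ} (hH : H ^ 2 = 1) {a b c : ℝ} (hac : a * c = 0)
    (habc : a ^ 2 + b ^ 2 + c ^ 2 = 1) :
    blockDeformation H a b c ^ 2 = 1 := by
  have hac' : (a : ℂ) * c = 0 := mod_cast hac
  have hca' : (c : ℂ) * a = 0 := by rw [mul_comm, hac']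
  have habc' : (a : ℂ) * a + c * c + b * b = 1 := by
    norm_cast
    linarith
  have hI : (Complex.I * b) * (Complex.I * b) = -((b : ℂ) * b) := by
    linear_combination (b : ℂ) * b * Complex.I_mul_I
  have hdiag : ((a : ℂ) • H + (c : ℂ) • 1) * ((a : ℂ) • H + (c : ℂ) • 1) +
      ((b : ℂ) * b) • (1 : Matrix m m ℂ) = 1 := by
    rw [sq] at hH
    simp only [add_mul, mul_add, smul_mul_smul_comm, hH, mul_one, one_mul, hac', hca',
      zero_smul, add_zero, zero_add, ← add_smul, habc', one_smul]
  rw [sq, blockDeformation, Matrix.fromBlocks_multiply, ← Matrix.fromBlocks_one]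
  congr 1
  · rw [mul_neg, smul_mul_smul_comm, hI, mul_one, neg_smul, neg_neg, hdiag]
  · simp
  · simp
  · rw [neg_mul, neg_mul_neg, smul_mul_smul_comm, hI, mul_one, neg_smul, neg_neg, add_comm, hdiag]

/-- **`H ⊕ (-H) ≈ 0`.** For any continuous family of Hermitian involutions `H`,
the block-diagonal family `G = H ⊕ (-H)` can be deformed, through Hermitian
involutions, to a constant diagonal matrix with diagonal entries `±1`. -/
theorem hamiltonian_oplus_neg_hamiltonian_trivial
    {X : Type*} [TopologicalSpace X] (n : ℕ)
    (H : X → Matrix (Fin n) (Fin n) ℂ) (hcont : Continuous H)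
    (hherm : ∀ x, (H x).IsHermitian) (hinv : ∀ x, (H x) ^ 2 = 1) :
    ∃ F : X × unitInterval → Matrix (Fin n ⊕ Fin n) (Fin n ⊕ Fin n) ℂ,
      Continuous F ∧
      (∀ x, F (x, 0) = Matrix.fromBlocks (H x) 0 0 (-(H x))) ∧
      (∀ p : X × unitInterval, (F p).IsHermitian ∧ (F p) ^ 2 = 1) ∧
      (∃ D : Matrix (Fin n ⊕ Fin n) (Fin n ⊕ Fin n) ℂ,
        (∀ x, F (x, 1) = D) ∧ D.IsDiag ∧ (∀ i, D i i = 1 ∨ D i i = -1)) := by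
  refine ⟨fun p => blockDeformation (H p.1) (max (Real.cos (Real.pi * p.2)) 0)
    (Real.sin (Real.pi * p.2)) (max (-Real.cos (Real.pi * p.2)) 0), ?_, ?_, ?_, ?_⟩
  · unfold blockDeformation
    refine Continuous.matrix_fromBlocks ?_ ?_ ?_ ?_ <;> fun_prop
  · intro x
    simp [blockDeformation]
  · intro p
    refine ⟨blockDeformation_isHermitian (hherm p.1) _ _ _,
      blockDeformation_sq (hinv p.1) ?_ ?_⟩
    · rcases le_total (Real.cos (Real.pi * p.2)) 0 with h | h <;> simp [h]
    · rcases le_total (Real.cos (Real.pi * p.2)) 0 with h | h <;> simp [h]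
  · refine ⟨Matrix.fromBlocks 1 0 0 (-1), fun x => by simp [blockDeformation],
      Matrix.isDiag_one.fromBlocks Matrix.isDiag_one.neg, ?_⟩
    rintro (i | i) <;> simp
end

section
/- Let X be a compact Hausdorff topological space and H : X → M_n(ℂ) a continuous map such that for every x ∈ X and every z in the spectrum of H(x) one has Re z ≠ 0 (a real line gap). Then there exists a continuous map F : X × [0,1] → M_n(ℂ) such that F(x,0) = H(x) for all x; for every (x,t) and every z in the spectrum of F(x,t) one has Re z ≠ 0; and for every x, the matrix F(x,1) is Hermitian with (F(x,1))² = 1. -/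
namespace Matrix

open scoped Topology ComplexOrder Matrix.Norms.L2Operator

variable {m k : Type*} [Fintype m] [Fintype k]

/-- The Hermitian matrix `G` is a Lyapunov certificate that `A` has no imaginary eigenvalues. -/
def IsLyapunov (G A : Matrix m m ℂ) : Prop :=
  G.IsHermitian ∧ (G * A + Aᴴ * G).PosDef

theorem isHermitian_mul_add {G A : Matrix m m ℂ} (hG : G.IsHermitian) :
    (G * A + Aᴴ * G).IsHermitian := by
  simp [IsHermitian, hG.eq, add_comm]

theorem convex_isLyapunov_left (A : Matrix m m ℂ) : Convex ℝ {G | IsLyapunov G A} := by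
  refine convex_iff_forall_pos.2 fun G hG K hK a b ha hb _ => ⟨?_, ?_⟩
  · simp [IsHermitian, conjTranspose_smul, (show Gᴴ = G from hG.1), (show Kᴴ = K from hK.1)]
  · convert! (hG.2.smul ha).add (hK.2.smul hb) using 1
    simp only [add_mul, mul_add, smul_mul, Matrix.mul_smul, smul_add]
    abel

theorem convex_isLyapunov_right (G : Matrix m m ℂ) : Convex ℝ {A | IsLyapunov G A} := by
  refine convex_iff_forall_pos.2 fun A hA B hB a b ha hb _ => ⟨hA.1, ?_⟩
  convert! (hA.2.smul ha).add (hB.2.smul hb) using 1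
  simp only [add_mul, mul_add, smul_mul, Matrix.mul_smul, smul_add, conjTranspose_add,
    conjTranspose_smul, star_trivial]
  abel

theorem IsLyapunov.re_ne_zero [DecidableEq m] {G A : Matrix m m ℂ} (h : IsLyapunov G A) {z : ℂ}
    (hz : z ∈ spectrum ℂ A) : z.re ≠ 0 := by
  intro hre
  rw [← spectrum_toLin', ← Module.End.hasEigenvalue_iff_mem_spectrum] at hz
  obtain ⟨v, hv⟩ := hz.exists_hasEigenvector
  have hAv : A *ᵥ v = z • v := by simpa using hv.apply_eq_smul
  have hpos := h.2.dotProduct_mulVec_pos hv.2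
  have hzero : star v ⬝ᵥ ((G * A + Aᴴ * G) *ᵥ v) = (z + star z) * (star v ⬝ᵥ (G *ᵥ v)) := by
    rw [add_mulVec, dotProduct_add, ← mulVec_mulVec, hAv, ← mulVec_mulVec,
      dotProduct_mulVec (star v) Aᴴ, ← star_mulVec, hAv, star_smul, mulVec_smul,
      dotProduct_smul, smul_dotProduct]
    simp only [smul_eq_mul]
    ring
  have : z + star z = 0 := by
    apply Complex.ext <;> simp [hre]
  rw [hzero, this, zero_mul] at hpos
  exact lt_irrefl _ hpos

theorem PosDef.eventually [DecidableEq m] {X : Type*} [TopologicalSpace X] {f : X → Matrix m m ℂ}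
    (hf : Continuous f) (hherm : ∀ x, (f x).IsHermitian) {x : X} (hx : (f x).PosDef) :
    ∀ᶠ y in 𝓝 x, (f y).PosDef := by
  have hopen := (upperHemicontinuous_spectrum ℝ (Matrix m m ℂ)).isOpen (Set.Ioi 0)
  have hmem : Set.Ioi (0 : ℝ) ∈ 𝓝ˢ (spectrum ℝ (f x)) := by
    rw [isOpen_Ioi.mem_nhdsSet, (hherm x).spectrum_real_eq_range_eigenvalues]
    rintro _ ⟨i, rfl⟩
    exact hx.eigenvalues_pos i
  filter_upwards [(hopen.preimage hf).mem_nhds hmem] with y hy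
  rw [(hherm y).posDef_iff_eigenvalues_pos]
  exact fun i => (subset_of_mem_nhdsSet hy) ((hherm y).eigenvalues_mem_spectrum_real i)

theorem IsLyapunov.eventually [DecidableEq m] {X : Type*} [TopologicalSpace X]
    {f : X → Matrix m m ℂ} (hf : Continuous f) {G : Matrix m m ℂ} {x : X}
    (h : IsLyapunov G (f x)) : ∀ᶠ y in 𝓝 x, IsLyapunov G (f y) := by
  have := PosDef.eventually (f := fun y => G * f y + (f y)ᴴ * G)
    (by fun_prop) (fun y => isHermitian_mul_add h.1) h.2
  filter_upwards [this] with y hy using ⟨h.1, hy⟩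

theorem IsLyapunov.conj [DecidableEq m] {G A : Matrix m m ℂ} (h : IsLyapunov G A)
    (P : (Matrix m m ℂ)ˣ) :
    IsLyapunov (P.valᴴ * G * P.val) (P⁻¹.val * A * P.val) := by
  refine ⟨isHermitian_conjTranspose_mul_mul _ h.1, ?_⟩
  have hPQ : P.val * P⁻¹.val = 1 := P.mul_inv
  have hQP : P⁻¹.valᴴ * P.valᴴ = 1 := by rw [← conjTranspose_mul, hPQ, conjTranspose_one]
  have heq : P.valᴴ * G * P.val * (P⁻¹.val * A * P.val) +
      (P⁻¹.val * A * P.val)ᴴ * (P.valᴴ * G * P.val) =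
      P.valᴴ * (G * A + Aᴴ * G) * P.val := by
    calc _ = P.valᴴ * G * (P.val * P⁻¹.val) * A * P.val +
          P.valᴴ * Aᴴ * (P⁻¹.valᴴ * P.valᴴ) * G * P.val := by
          simp only [conjTranspose_mul, mul_assoc]
      _ = _ := by
          rw [hPQ, hQP]
          simp only [mul_one, mul_add, add_mul, mul_assoc]
  rw [heq]
  exact h.2.conjTranspose_mul_mul_same (mulVec_injective_of_isUnit P.isUnit)

theorem IsLyapunov.fromBlocks_diagonal {G A : Matrix m m ℂ} {K D : Matrix k k ℂ}
    (h : IsLyapunov G A) (h' : IsLyapunov K D) :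
    IsLyapunov (fromBlocks G 0 0 K) (fromBlocks A 0 0 D) := by
  refine ⟨h.1.fromBlocks (by simp) h'.1, ?_⟩
  refine .of_dotProduct_mulVec_pos
    (isHermitian_mul_add (h.1.fromBlocks (by simp) h'.1)) fun v hv => ?_
  obtain ⟨u, w, rfl⟩ : ∃ u w, v = Sum.elim u w := ⟨v ∘ Sum.inl, v ∘ Sum.inr, by simp⟩
  have hform : star (Sum.elim u w) ⬝ᵥ ((fromBlocks G 0 0 K * fromBlocks A 0 0 D +
      (fromBlocks A 0 0 D)ᴴ * fromBlocks G 0 0 K) *ᵥ Sum.elim u w) =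
      star u ⬝ᵥ ((G * A + Aᴴ * G) *ᵥ u) + star w ⬝ᵥ ((K * D + Dᴴ * K) *ᵥ w) := by
    simp [fromBlocks_conjTranspose, fromBlocks_multiply, fromBlocks_add, fromBlocks_mulVec,
      Function.star_sumElim]
  rw [hform]
  by_cases hu : u = 0
  · subst hu
    have hw : w ≠ 0 := by
      rintro rfl
      exact hv (by simp)
    simpa using h'.2.dotProduct_mulVec_pos hw
  · exact add_pos_of_pos_of_nonneg (h.2.dotProduct_mulVec_pos hu)
      (h'.2.posSemidef.dotProduct_mulVec_nonneg w)

theorem exists_isLyapunov_unit {A : Matrix Unit Unit ℂ} (h : (A () ()).re ≠ 0) :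
    ∃ G, IsLyapunov G A := by
  refine ⟨diagonal fun _ => ((A () ()).re : ℂ),
    by simp [IsHermitian, diagonal_conjTranspose, Pi.star_def], ?_⟩
  have heq : (diagonal fun _ => ((A () ()).re : ℂ)) * A +
      Aᴴ * (diagonal fun _ => ((A () ()).re : ℂ)) =
      diagonal fun _ => ((2 * (A () ()).re ^ 2 : ℝ) : ℂ) := by
    ext i j
    simp [diagonal_mul, mul_diagonal]
    apply Complex.ext <;> simp [sq] <;> ring
  rw [heq, posDef_diagonal_iff]
  intro i
  exact_mod_cast (by positivity : 0 < 2 * (A () ()).re ^ 2)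

theorem spectrum_fromBlocks_zero₂₁ [DecidableEq m] [DecidableEq k] (A : Matrix m m ℂ)
    (B : Matrix m k ℂ) (D : Matrix k k ℂ) :
    spectrum ℂ (fromBlocks A B 0 D) = spectrum ℂ A ∪ spectrum ℂ D := by
  ext z
  have : algebraMap ℂ (Matrix (m ⊕ k) (m ⊕ k) ℂ) z - fromBlocks A B 0 D =
      fromBlocks (algebraMap ℂ _ z - A) (-B) 0 (algebraMap ℂ _ z - D) := by
    ext (i | i) (j | j) <;> simp [algebraMap_matrix_apply]
  rw [Set.mem_union, spectrum.mem_iff, spectrum.mem_iff, spectrum.mem_iff, this,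
    isUnit_fromBlocks_zero₂₁, not_and_or]

theorem exists_isLyapunov_fromBlocks [DecidableEq m] [DecidableEq k] {A : Matrix m m ℂ}
    (B : Matrix m k ℂ) {D : Matrix k k ℂ} (hA : ∃ G, IsLyapunov G A)
    (hD : ∃ K, IsLyapunov K D) : ∃ L, IsLyapunov L (fromBlocks A B 0 D) := by
  obtain ⟨G, hG⟩ := hA
  obtain ⟨K, hK⟩ := hD
  have hcont : Continuous fun ε : ℂ => fromBlocks A (ε • B) 0 D := by fun_prop
  have hev := IsLyapunov.eventually hcont (x := 0) (G := fromBlocks G 0 0 K)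
    (by simpa using hG.fromBlocks_diagonal hK)
  obtain ⟨ε, hε, hε0⟩ := ((hev.filter_mono nhdsWithin_le_nhds).and
    (self_mem_nhdsWithin : {0}ᶜ ∈ 𝓝[≠] (0 : ℂ))).exists
  have hε0 : ε ≠ 0 := hε0
  have hinv : ∀ a b : ℂ, a * b = 1 → fromBlocks (a • 1 : Matrix m m ℂ) 0 0 (1 : Matrix k k ℂ) *
      fromBlocks (b • 1) 0 0 1 = 1 := by
    intro a b hab
    simp [fromBlocks_multiply, smul_smul, hab, mul_comm b a]
  let P : (Matrix (m ⊕ k) (m ⊕ k) ℂ)ˣ :=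
    ⟨fromBlocks (ε • 1) 0 0 1, fromBlocks (ε⁻¹ • 1) 0 0 1,
      hinv _ _ (mul_inv_cancel₀ hε0), hinv _ _ (inv_mul_cancel₀ hε0)⟩
  have heq : P⁻¹.val * fromBlocks A (ε • B) 0 D * P.val = fromBlocks A B 0 D := by
    simp [P, fromBlocks_multiply, smul_smul, hε0]
  exact ⟨_, heq ▸ hε.conj P⟩

theorem exists_units_conj_eq_fromBlocks {n : ℕ}
    (A : Matrix (Unit ⊕ Fin n) (Unit ⊕ Fin n) ℂ) :
    ∃ (P : (Matrix (Unit ⊕ Fin n) (Unit ⊕ Fin n) ℂ)ˣ) (a : Matrix Unit Unit ℂ)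
      (B : Matrix Unit (Fin n) ℂ) (D : Matrix (Fin n) (Fin n) ℂ),
      A = P⁻¹.val * fromBlocks a B 0 D * P.val := by
  obtain ⟨z, hz⟩ := Module.End.exists_eigenvalue (toLin' A)
  obtain ⟨v, hv⟩ := hz.exists_hasEigenvector
  have hAv : A *ᵥ v = z • v := by simpa using hv.apply_eq_smul
  obtain ⟨L, hL⟩ := SeparatingDual.exists_continuousLinearEquiv_apply_eq (R := ℂ) hv.2
    (Pi.single_ne_zero_iff.2 one_ne_zero :
      (Pi.single (Sum.inl ()) 1 : Unit ⊕ Fin n → ℂ) ≠ 0)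
  let P : (Matrix (Unit ⊕ Fin n) (Unit ⊕ Fin n) ℂ)ˣ :=
    ⟨LinearMap.toMatrix' L.toLinearEquiv.toLinearMap,
      LinearMap.toMatrix' L.toLinearEquiv.symm.toLinearMap,
      by simp [← LinearMap.toMatrix'_comp], by simp [← LinearMap.toMatrix'_comp]⟩
  have hPv : P.val *ᵥ v = Pi.single (Sum.inl ()) 1 := by
    simpa [P, LinearMap.toMatrix'_mulVec] using hL
  have hQ : P⁻¹.val *ᵥ Pi.single (Sum.inl ()) 1 = v := by
    rw [← hPv, mulVec_mulVec, P.inv_mul, one_mulVec]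
  set T := P.val * A * P⁻¹.val with hT
  have hcol : T.col (Sum.inl ()) = z • Pi.single (Sum.inl ()) 1 := by
    rw [← mulVec_single_one, hT, ← mulVec_mulVec, hQ, ← mulVec_mulVec, hAv, mulVec_smul, hPv]
  have hzero : T.toBlocks₂₁ = 0 := by
    ext i j
    simpa [toBlocks₂₁] using congrFun hcol (Sum.inr i)
  refine ⟨P, T.toBlocks₁₁, T.toBlocks₁₂, T.toBlocks₂₂, ?_⟩
  rw [← hzero, fromBlocks_toBlocks, hT, mul_assoc, mul_assoc, P.inv_mul, mul_one, ← mul_assoc,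
    P.inv_mul, one_mul]

theorem IsLyapunov.submatrix {G A : Matrix m m ℂ} (h : IsLyapunov G A) (e : k ≃ m) :
    IsLyapunov (G.submatrix e e) (A.submatrix e e) := by
  refine ⟨h.1.submatrix e, ?_⟩
  convert! h.2.submatrix e.injective using 1
  ext i j
  simp [conjTranspose_submatrix, submatrix_mul_equiv]

/-- **Lyapunov inertia theorem.** A matrix without imaginary eigenvalues has a certificate. -/
theorem exists_isLyapunov {n : ℕ} {A : Matrix (Fin n) (Fin n) ℂ}
    (h : ∀ z ∈ spectrum ℂ A, z.re ≠ 0) : ∃ G, IsLyapunov G A := by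
  induction n with
  | zero => exact ⟨0, by simp, .of_dotProduct_mulVec_pos (by simp [IsHermitian])
      fun v hv => (hv (Subsingleton.elim _ _)).elim⟩
  | succ n ih =>
    let e : Fin (n + 1) ≃ Unit ⊕ Fin n := Fintype.equivOfCardEq (by simp [add_comm])
    obtain ⟨P, a, B, D, hP⟩ := exists_units_conj_eq_fromBlocks (A.submatrix e.symm e.symm)
    have hspec : spectrum ℂ A = spectrum ℂ a ∪ spectrum ℂ D := by
      rw [← AlgEquiv.spectrum_eq (reindexAlgEquiv ℂ ℂ e) A, coe_reindexAlgEquiv, reindex_apply,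
        hP, spectrum.units_conjugate', spectrum_fromBlocks_zero₂₁]
    rw [hspec] at h
    have ha : (a () ()) ∈ spectrum ℂ a := by
      rw [spectrum.mem_iff, isUnit_iff_isUnit_det]
      simp [algebraMap_matrix_apply]
    obtain ⟨L, hL⟩ := exists_isLyapunov_fromBlocks B
      (exists_isLyapunov_unit (h _ (Or.inl ha))) (ih fun z hz => h z (Or.inr hz))
    have := (hL.conj P).submatrix e
    rw [← hP] at this
    exact ⟨_, by simpa using this⟩

theorem continuousOn_div_abs [DecidableEq m] {G : Matrix m m ℂ} (hG : IsUnit G) :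
    ContinuousOn (fun r : ℝ => r / |r|) (spectrum ℝ G) := by
  have : ∀ r ∈ spectrum ℝ G, |r| ≠ 0 := fun r hr =>
    abs_ne_zero.2 fun h => spectrum.zero_notMem ℝ hG (h ▸ hr)
  fun_prop (disch := assumption)

theorem isUnit_of_isLyapunov [DecidableEq m] {G A : Matrix m m ℂ} (h : IsLyapunov G A) :
    IsUnit G := by
  rw [isUnit_iff_isUnit_det, isUnit_iff_ne_zero]
  intro hdet
  obtain ⟨v, hv, hGv⟩ := exists_mulVec_eq_zero_iff.2 hdet
  have hpos := h.2.dotProduct_mulVec_pos hv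
  have hGv' : star v ᵥ* G = 0 := by
    rw [← h.1.eq, ← star_mulVec, hGv, star_zero]
  rw [add_mulVec, dotProduct_add, ← mulVec_mulVec, ← mulVec_mulVec, hGv, mulVec_zero,
    dotProduct_zero, add_zero, dotProduct_mulVec, hGv', zero_dotProduct] at hpos
  exact lt_irrefl _ hpos

/-- The sign of a Hermitian matrix. -/
noncomputable def hermitianSign [DecidableEq m] (G : Matrix m m ℂ) : Matrix m m ℂ :=
  cfc (fun r : ℝ => r / |r|) G

theorem isHermitian_hermitianSign [DecidableEq m] (G : Matrix m m ℂ) :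
    (hermitianSign G).IsHermitian :=
  cfc_predicate (p := IsSelfAdjoint) (fun r : ℝ => r / |r|) G

theorem hermitianSign_sq [DecidableEq m] {G : Matrix m m ℂ} (hG : G.IsHermitian)
    (hu : IsUnit G) : hermitianSign G ^ 2 = 1 := by
  have hsa : IsSelfAdjoint G := hG
  rw [hermitianSign, ← cfc_pow _ _ _ (continuousOn_div_abs hu), ← cfc_one ℝ G]
  refine cfc_congr fun r hr => ?_
  have : r ≠ 0 := fun h => spectrum.zero_notMem ℝ hu (h ▸ hr)
  simp [div_pow, this]

theorem isLyapunov_hermitianSign [DecidableEq m] {G : Matrix m m ℂ} (hG : G.IsHermitian)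
    (hu : IsUnit G) : IsLyapunov G (hermitianSign G) := by
  have hsa : IsSelfAdjoint G := hG
  have hne : ∀ r ∈ spectrum ℝ G, r ≠ 0 := fun r hr h => spectrum.zero_notMem ℝ hu (h ▸ hr)
  have hc := continuousOn_div_abs hu
  have heq : G * hermitianSign G + (hermitianSign G)ᴴ * G = cfc (fun r : ℝ => 2 * |r|) G := by
    rw [(isHermitian_hermitianSign G).eq, hermitianSign]
    nth_rw 1 4 [← cfc_id ℝ G]
    rw [← cfc_mul _ _ _ continuousOn_id hc, ← cfc_mul _ _ _ hc continuousOn_id,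
      ← cfc_add G _ _ (ContinuousOn.fun_mul continuousOn_id hc)
        (ContinuousOn.fun_mul hc continuousOn_id)]
    refine cfc_congr fun r hr => ?_
    have : |r| ≠ 0 := abs_ne_zero.2 (hne r hr)
    simp only [id]
    field_simp
    rw [sq_abs]
    ring
  have hherm : (cfc (fun r : ℝ => 2 * |r|) G).IsHermitian :=
    cfc_predicate (p := IsSelfAdjoint) (fun r : ℝ => 2 * |r|) G
  refine ⟨hG, ?_⟩
  rw [heq, hherm.posDef_iff_eigenvalues_pos]
  intro i
  have hi := hherm.eigenvalues_mem_spectrum_real i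
  rw [cfc_map_spectrum (fun r : ℝ => 2 * |r|) G] at hi
  obtain ⟨r, hr, hri⟩ := hi
  rw [← hri]
  have := hne r hr
  positivity

theorem continuous_hermitianSign [DecidableEq m] {X : Type*} [TopologicalSpace X]
    {G : X → Matrix m m ℂ} (hcont : Continuous G) (hG : ∀ x, (G x).IsHermitian)
    (hu : ∀ x, IsUnit (G x)) : Continuous fun x => hermitianSign (G x) := by
  refine Continuous.cfc_of_mem_nhdsSet (s := {0}ᶜ) _ ?_ hcont (fun x => hG x) ?_
  · rw [isOpen_compl_singleton.mem_nhdsSet]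
    exact Set.iUnion_subset fun x =>
      Set.subset_compl_singleton_iff.2 (spectrum.zero_notMem ℝ (hu x))
  · have : ∀ r ∈ ({0}ᶜ : Set ℝ), |r| ≠ 0 := fun r hr => abs_ne_zero.2 hr
    fun_prop (disch := assumption)

theorem exists_continuous_isLyapunov {X : Type*} [TopologicalSpace X] [CompactSpace X] [T2Space X]
    {n : ℕ} {H : X → Matrix (Fin n) (Fin n) ℂ} (hcont : Continuous H)
    (hgap : ∀ x, ∀ z ∈ spectrum ℂ (H x), z.re ≠ 0) :
    ∃ G : C(X, Matrix (Fin n) (Fin n) ℂ), ∀ x, IsLyapunov (G x) (H x) :=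
  exists_continuous_forall_mem_convex_of_local_const
    (fun x => convex_isLyapunov_left (H x)) fun x =>
      (exists_isLyapunov (hgap x)).imp fun _ h => h.eventually hcont

end Matrix

/-- **Flattening for real line gaps.** A continuous family of matrices over a compact
Hausdorff space all of whose eigenvalues have nonzero real part can be deformed,
through families with a real line gap, to a family of Hermitian involutions. -/
theorem real_line_gap_flattening
    {X : Type*} [TopologicalSpace X] [CompactSpace X] [T2Space X] (n : ℕ)
    (H : X → Matrix (Fin n) (Fin n) ℂ) (hcont : Continuous H)
    (hgap : ∀ x, ∀ z ∈ spectrum ℂ (H x), z.re ≠ 0) :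
    ∃ F : X × unitInterval → Matrix (Fin n) (Fin n) ℂ,
      Continuous F ∧
      (∀ x, F (x, 0) = H x) ∧
      (∀ p : X × unitInterval, ∀ z ∈ spectrum ℂ (F p), z.re ≠ 0) ∧
      (∀ x, (F (x, 1)).IsHermitian ∧ (F (x, 1)) ^ 2 = 1) := by
  obtain ⟨G, hG⟩ := Matrix.exists_continuous_isLyapunov hcont hgap
  have hu x := Matrix.isUnit_of_isLyapunov (hG x)
  have hS := Matrix.continuous_hermitianSign G.continuous (fun x => (hG x).1) hu
  refine ⟨fun p => (1 - p.2 : ℝ) • H p.1 + (p.2 : ℝ) • (G p.1).hermitianSign,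
    ((continuous_const.sub (continuous_subtype_val.comp continuous_snd)).smul
      (hcont.comp continuous_fst)).add
      ((continuous_subtype_val.comp continuous_snd).smul (hS.comp continuous_fst)),
    fun x => by simp, fun p z hz => ?_, fun x => ?_⟩
  · refine Matrix.IsLyapunov.re_ne_zero (Matrix.convex_isLyapunov_right (G p.1) (hG p.1)
      (Matrix.isLyapunov_hermitianSign (hG p.1).1 (hu p.1)) ?_ p.2.2.1 (by simp)) hz
    exact sub_nonneg.2 p.2.2.2
  · simpa using And.intro (Matrix.isHermitian_hermitianSign (G x))
      (Matrix.hermitianSign_sq (hG x).1 (hu x))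
end

section
/- Let X be a compact Hausdorff topological space and H : X → M_n(ℂ) a continuous map such that for every x ∈ X and every z in the spectrum of H(x) one has Im z ≠ 0 (an imaginary line gap). Then there exists a continuous map F : X × [0,1] → M_n(ℂ) such that F(x,0) = H(x) for all x; for every (x,t) and every z in the spectrum of F(x,t) one has Im z ≠ 0; and for every x, the matrix F(x,1) is anti-Hermitian (F(x,1)ᴴ = −F(x,1)) with (F(x,1))² = −1. -/
open Matrix

namespace Matrix

open Polynomial

variable {n : Type*} [Fintype n] [DecidableEq n]

theorem mem_spectrum_of_mul_eq_smul {K : Type*} [Field K] {M X : Matrix n n K} {z : K}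
    (hX : X ≠ 0) (h : M * X = z • X) : z ∈ spectrum K M := by
  rw [spectrum.mem_iff]
  rintro ⟨u, hu⟩
  have h0 : (u : Matrix n n K) * X = 0 := by
    rw [hu, sub_mul, h, Algebra.algebraMap_eq_smul_one, smul_mul_assoc, one_mul, sub_self]
  exact hX ((Units.mul_right_eq_zero u).1 h0)

theorem exists_mul_eq_smul_of_mem_spectrum {K : Type*} [Field K] {M : Matrix n n K} {z : K}
    (h : z ∈ spectrum K M) : ∃ X : Matrix n n K, X ≠ 0 ∧ M * X = z • X := by
  rw [spectrum.mem_iff, isUnit_iff_isUnit_det, isUnit_iff_ne_zero, not_not,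
    ← exists_mulVec_eq_zero_iff] at h
  obtain ⟨v, hv, h⟩ := h
  refine ⟨vecMulVec v v, fun h0 => hv (funext fun i => ?_), ?_⟩
  · simpa [vecMulVec_apply] using congrFun (congrFun h0 i) i
  · rw [sub_mulVec, Algebra.algebraMap_eq_smul_one, smul_mulVec, one_mulVec, sub_eq_zero] at h
    rw [mul_vecMulVec, ← h, smul_vecMulVec]

theorem exists_mul_eq_smul_of_mem_spectrum' {K : Type*} [Field K] {M : Matrix n n K} {z : K}
    (h : z ∈ spectrum K M) : ∃ X : Matrix n n K, X ≠ 0 ∧ X * M = z • X := by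
  rw [spectrum.mem_iff, isUnit_iff_isUnit_det, isUnit_iff_ne_zero, not_not,
    ← exists_vecMul_eq_zero_iff] at h
  obtain ⟨v, hv, h⟩ := h
  refine ⟨vecMulVec v v, fun h0 => hv (funext fun i => ?_), ?_⟩
  · simpa [vecMulVec_apply] using congrFun (congrFun h0 i) i
  · rw [vecMul_sub, Algebra.algebraMap_eq_smul_one, vecMul_smul, vecMul_one, sub_eq_zero] at h
    rw [vecMulVec_mul, ← h, vecMulVec_smul]

theorem mem_spectrum_of_mul_eq_smul' {K : Type*} [Field K] {M X : Matrix n n K} {z : K}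
    (hX : X ≠ 0) (h : X * M = z • X) : z ∈ spectrum K M := by
  rw [spectrum.mem_iff]
  rintro ⟨u, hu⟩
  have h0 : X * (u : Matrix n n K) = 0 := by
    rw [hu, mul_sub, h, Algebra.algebraMap_eq_smul_one, mul_smul_comm, mul_one, sub_self]
  exact hX ((Units.mul_left_eq_zero u).1 h0)

theorem aeval_mul_eq_eval_smul {K : Type*} [Field K] {M X : Matrix n n K} {z : K}
    (h : M * X = z • X) (p : K[X]) : aeval M p * X = p.eval z • X := by
  induction p using Polynomial.induction_on' with
  | add p q hp hq => simp [add_mul, add_smul, hp, hq]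
  | monomial k a =>
    have hk : M ^ k * X = z ^ k • X := by
      induction k with
      | zero => simp
      | succ k ih => rw [pow_succ, mul_assoc, h, mul_smul_comm, ih, smul_smul, pow_succ']
    rw [aeval_monomial, eval_monomial, Algebra.algebraMap_eq_smul_one, smul_mul_assoc, one_mul,
      smul_mul_assoc, hk, smul_smul]

theorem mul_aeval_eq_aeval_mul {K : Type*} [Field K] {B C X : Matrix n n K}
    (h : B * X = X * C) (p : K[X]) : X * aeval C p = aeval B p * X := by
  induction p using Polynomial.induction_on' with
  | add p q hp hq => simp [add_mul, mul_add, hp, hq]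
  | monomial k a =>
    have hk : X * C ^ k = B ^ k * X := (SemiconjBy.pow_right (show SemiconjBy X C B from h.symm) k)
    simp only [aeval_monomial, Algebra.algebraMap_eq_smul_one, smul_mul_assoc, one_mul,
      mul_smul_comm, hk]

/-- **Sylvester**: the equation `B * X = X * C` has only the trivial solution when the spectra of
`B` and `C` are disjoint. -/
theorem eq_zero_of_mul_eq_mul_of_disjoint_spectrum {B C X : Matrix n n ℂ} (h : B * X = X * C)
    (hd : Disjoint (spectrum ℂ B) (spectrum ℂ C)) : X = 0 := by
  have hc : IsCoprime B.charpoly C.charpoly := by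
    rw [isCoprime_iff_aeval_ne_zero_of_isAlgClosed (k := ℂ) ℂ]
    intro a
    by_contra! ha
    rw [coe_aeval_eq_eval] at ha
    exact Set.disjoint_left.1 hd (mem_spectrum_iff_isRoot_charpoly.2 ha.1)
      (mem_spectrum_iff_isRoot_charpoly.2 ha.2)
  obtain ⟨a, b, hab⟩ := hc
  have h1 := mul_aeval_eq_aeval_mul h (a * B.charpoly)
  have h2 : aeval C (a * B.charpoly) = 1 := by
    rw [eq_sub_of_add_eq hab]
    simp [aeval_self_charpoly]
  rw [h2, map_mul, aeval_self_charpoly] at h1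
  simpa using h1

open scoped ComplexOrder in
/-- An idempotent matrix has the same range as some orthogonal projection. -/
theorem exists_orthogonalProjection_of_isIdempotentElem {p : Matrix n n ℂ} (hp : p * p = p) :
    ∃ r : Matrix n n ℂ, rᴴ = r ∧ r * r = r ∧ p * r = r ∧ r * p = p := by
  set z : Matrix n n ℂ := 1 + (p - pᴴ)ᴴ * (p - pᴴ) with hz
  have hzu : IsUnit z :=
    (PosDef.one.add_posSemidef (posSemidef_conjTranspose_mul_self _)).isUnit
  have hpH : pᴴ * pᴴ = pᴴ := by rw [← conjTranspose_mul, hp]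
  have hze : z = 1 + pᴴ * p + p * pᴴ - p - pᴴ := by
    rw [hz, conjTranspose_sub, conjTranspose_conjTranspose, mul_sub, sub_mul, sub_mul, hp, hpH]
    abel
  have hzH : zᴴ = z := by
    rw [hze]; simp only [conjTranspose_add, conjTranspose_sub, conjTranspose_mul,
      conjTranspose_conjTranspose, conjTranspose_one]
    abel
  have hzp : z * p = p * pᴴ * p := by
    rw [hze]; simp only [add_mul, sub_mul, one_mul, mul_assoc, hp]
    abel
  have hpz : p * z = p * pᴴ * p := by
    rw [hze]; simp only [mul_add, mul_sub, mul_one, ← mul_assoc, hp]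
    abel
  have hpHz : pᴴ * z = z * pᴴ := by
    have := congrArg conjTranspose (hzp.trans hpz.symm)
    simpa only [conjTranspose_mul, hzH] using this
  obtain ⟨u, hu⟩ := hzu
  obtain ⟨v, hv⟩ : ∃ v : Matrix n n ℂ, v = ↑u⁻¹ := ⟨_, rfl⟩
  have hvz : v * z = 1 := by rw [hv, ← hu, Units.inv_mul]
  have hc1 : p * v = v * p :=
    hv ▸ (Commute.units_inv_right (show Commute p u by rw [hu]; exact hpz.trans hzp.symm)).eq
  have hc2 : pᴴ * v = v * pᴴ :=
    hv ▸ (Commute.units_inv_right (show Commute pᴴ u by rw [hu]; exact hpHz)).eq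
  have hvH : vᴴ = v := by
    rw [hv, coe_units_inv, conjTranspose_nonsing_inv, hu, hzH]
  have hrp : v * (p * pᴴ) * p = p := by
    rw [mul_assoc, ← hzp, ← mul_assoc, hvz, one_mul]
  have hpr : p * (v * (p * pᴴ)) = v * (p * pᴴ) := by
    rw [← mul_assoc, hc1, mul_assoc, ← mul_assoc p, hp]
  refine ⟨v * (p * pᴴ), ?_, ?_, hpr, hrp⟩
  · rw [conjTranspose_mul, conjTranspose_mul, conjTranspose_conjTranspose, hvH, mul_assoc, hc2,
      ← mul_assoc, hc1, mul_assoc]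
  · calc v * (p * pᴴ) * (v * (p * pᴴ)) = v * p * (pᴴ * v) * p * pᴴ := by simp only [mul_assoc]
      _ = v * (p * v) * (pᴴ * p * pᴴ) := by rw [hc2]; simp only [mul_assoc]
      _ = v * (v * (p * pᴴ * p)) * pᴴ := by rw [hc1]; simp only [mul_assoc]
      _ = v * (p * pᴴ) := by rw [← hzp, ← mul_assoc v z, hvz, one_mul, mul_assoc]

/-- The data of an orthogonal projection `r` onto an `A`-invariant subspace such that the
compressions of `A` to the range and to the kernel of `r` have spectrum in the open right,
respectively left, half plane. The compressions are extended to the whole space by `1` and `-1`. -/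
structure IsDichotomyProjection (A r : Matrix n n ℂ) : Prop where
  conjTranspose_eq : rᴴ = r
  mul_self : r * r = r
  invariant : r * A * r = A * r
  re_pos : ∀ z ∈ spectrum ℂ (r * A * r + (1 - r)), 0 < z.re
  re_neg : ∀ z ∈ spectrum ℂ ((1 - r) * A * (1 - r) - r), z.re < 0

namespace IsDichotomyProjection

variable {A r s : Matrix n n ℂ}

theorem compl_mul_mul_compl (h : r * A * r = A * r) :
    (1 - r) * A * (1 - r) = (1 - r) * A := by
  rw [mul_sub, mul_one, sub_eq_self, sub_mul, sub_mul, h, one_mul, sub_self]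

theorem mul_eq_self_of_compression_mul {X : Matrix n n ℂ} {z : ℂ} (h2 : r * r = r)
    (h3 : r * A * r = A * r) (hz : z ≠ 1) (h : (r * A * r + (1 - r)) * X = z • X) :
    r * X = X ∧ A * X = z • X := by
  have h6 : (1 - r) * r = 0 := by rw [sub_mul, one_mul, h2, sub_self]
  have h7 : (1 - r) * (1 - r) = 1 - r := by rw [mul_sub, h6, mul_one, sub_zero]
  have hY : (1 - r) * X = 0 := by
    have h9 : (1 - r) * ((r * A * r + (1 - r)) * X) = (1 - r) * X := by
      calc (1 - r) * ((r * A * r + (1 - r)) * X)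
          = (1 - r) * r * (A * r * X) + (1 - r) * (1 - r) * X := by noncomm_ring
        _ = _ := by rw [h6, h7]; simp
    rw [h, mul_smul_comm] at h9
    have h10 : (z - 1) • ((1 - r) * X) = 0 := by rw [sub_smul, h9, one_smul, sub_self]
    exact (smul_eq_zero.1 h10).resolve_left (sub_ne_zero.2 hz)
  have hrX : r * X = X := by rwa [sub_mul, one_mul, sub_eq_zero, eq_comm] at hY
  exact ⟨hrX, by rwa [add_mul, hY, add_zero, h3, mul_assoc, hrX] at h⟩

theorem mul_eq (hr : IsDichotomyProjection A r) (hs : IsDichotomyProjection A s) :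
    s * r = r := by
  have h : (1 - s) * r = 0 := by
    apply eq_zero_of_mul_eq_mul_of_disjoint_spectrum
      (B := (1 - s) * A * (1 - s) - s) (C := r * A * r + (1 - r))
    · have h1 := compl_mul_mul_compl hs.invariant
      have h2 : s * (1 - s) = 0 := by rw [mul_sub, mul_one, hs.mul_self, sub_self]
      have h3 : r * (1 - r) = 0 := by rw [mul_sub, mul_one, hr.mul_self, sub_self]
      calc ((1 - s) * A * (1 - s) - s) * ((1 - s) * r)
          = (1 - s) * A * (1 - s) * (1 - s) * r - s * (1 - s) * r := by noncomm_ring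
        _ = (1 - s) * (A * r) := by rw [h1, h1, h2]; simp [mul_assoc]
        _ = (1 - s) * (r * (r * A * r)) + (1 - s) * (r * (1 - r)) := by
            rw [h3, ← mul_assoc r, ← mul_assoc r r, hr.mul_self, hr.invariant]; simp
        _ = _ := by noncomm_ring
    · rw [Set.disjoint_left]
      intro z hz hz'
      exact lt_asymm (hs.re_neg z hz) (hr.re_pos z hz')
  rw [sub_mul, one_mul, sub_eq_zero] at h
  exact h.symm

theorem unique (hr : IsDichotomyProjection A r) (hs : IsDichotomyProjection A s) : r = s := by
  have h := congrArg conjTranspose (hr.mul_eq hs)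
  rw [conjTranspose_mul, hr.conjTranspose_eq, hs.conjTranspose_eq, hs.mul_eq hr] at h
  exact h.symm

theorem re_ne_zero (hr : IsDichotomyProjection A r) {z : ℂ} (hz : z ∈ spectrum ℂ A) :
    z.re ≠ 0 := by
  intro h0
  obtain ⟨X, hX, h⟩ := exists_mul_eq_smul_of_mem_spectrum hz
  have h1 := compl_mul_mul_compl hr.invariant
  have h2 : r * (1 - r) = 0 := by rw [mul_sub, mul_one, hr.mul_self, sub_self]
  have hY : (1 - r) * X = 0 := by
    by_contra hY
    refine (hr.re_neg z (mem_spectrum_of_mul_eq_smul hY ?_)).ne h0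
    calc ((1 - r) * A * (1 - r) - r) * ((1 - r) * X)
        = (1 - r) * A * (1 - r) * (1 - r) * X - r * (1 - r) * X := by noncomm_ring
      _ = (1 - r) * (A * X) := by rw [h1, h1, h2]; simp [mul_assoc]
      _ = _ := by rw [h, mul_smul_comm]
  have hrX : r * X = X := by rwa [sub_mul, one_mul, sub_eq_zero, eq_comm] at hY
  refine (hr.re_pos z (mem_spectrum_of_mul_eq_smul hX ?_)).ne' h0
  rw [add_mul, hY, add_zero, hr.invariant, mul_assoc, hrX, h]

/-- The projection of `A` remains a dichotomy projection along the segment from `A` to the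
reflection `2r - 1`. -/
theorem segment (hr : IsDichotomyProjection A r) {t : ℝ} (ht0 : 0 ≤ t) (ht1 : t ≤ 1) :
    IsDichotomyProjection (((1 - t : ℝ) : ℂ) • A + (t : ℂ) • (2 * r - 1)) r := by
  have key : ∀ {M : Matrix n n ℂ} {e : ℝ}, (∀ z ∈ spectrum ℂ M, 0 < e * z.re) → e * e = 1 →
      ∀ z ∈ spectrum ℂ (((1 - t : ℝ) : ℂ) • M + ((t * e : ℝ) : ℂ) • 1), 0 < e * z.re := by
    intro M e hM he z hz
    obtain ⟨X, hX, h⟩ := exists_mul_eq_smul_of_mem_spectrum hz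
    rw [add_mul, smul_mul_assoc, smul_mul_assoc, one_mul, ← eq_sub_iff_add_eq, ← sub_smul] at h
    rcases ht1.eq_or_lt with rfl | ht
    · have : z = e := by
        simpa [hX, sub_eq_zero, eq_comm] using h
      rw [this, Complex.ofReal_re, he]; exact one_pos
    · have h1t : ((1 - t : ℝ) : ℂ) ≠ 0 := by exact_mod_cast (sub_pos.2 ht).ne'
      have h' : M * X = (((1 - t)⁻¹ : ℝ) * (z - ((t * e : ℝ) : ℂ))) • X := by
        rw [← smul_smul, ← h, smul_smul, ← Complex.ofReal_mul, inv_mul_cancel₀ (sub_pos.2 ht).ne']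
        simp
      have := hM _ (mem_spectrum_of_mul_eq_smul hX h')
      rw [Complex.re_ofReal_mul, Complex.sub_re, Complex.ofReal_re] at this
      have h3 : 0 < e * (z.re - t * e) := by
        have := mul_pos (sub_pos.2 ht) this
        rwa [mul_left_comm, mul_inv_cancel_left₀ (sub_pos.2 ht).ne'] at this
      nlinarith
  have h2 : r * (1 - r) = 0 := by rw [mul_sub, mul_one, hr.mul_self, sub_self]
  have h3 : (1 - r) * r = 0 := by rw [sub_mul, one_mul, hr.mul_self, sub_self]
  have hJ : r * (2 * r - 1) = r := by
    calc r * (2 * r - 1) = 2 * (r * r) - r := by noncomm_ring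
      _ = r := by rw [hr.mul_self]; noncomm_ring
  have hJ' : (2 * r - 1) * r = r := by
    calc (2 * r - 1) * r = 2 * (r * r) - r := by noncomm_ring
      _ = r := by rw [hr.mul_self]; noncomm_ring
  refine ⟨hr.conjTranspose_eq, hr.mul_self, ?_, ?_, ?_⟩
  · simp only [mul_add, add_mul, mul_smul_comm, smul_mul_assoc, hr.invariant, hJ, hJ', hr.mul_self]
  · have := key (M := r * A * r + (1 - r)) (e := 1) (by simpa using hr.re_pos) (by simp)
    intro z hz
    rw [← one_mul z.re]
    refine this z ?_
    convert hz using 2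
    simp only [mul_add, add_mul, mul_smul_comm, smul_mul_assoc, hr.invariant, hJ, hr.mul_self]
    push_cast
    module
  · have := key (M := (1 - r) * A * (1 - r) - r) (e := -1) (by simpa using hr.re_neg) (by simp)
    have hJ2 : (1 - r) * (2 * r - 1) * (1 - r) = r - 1 := by
      calc (1 - r) * (2 * r - 1) * (1 - r)
          = (1 - r) * (r * (1 - r)) - (1 - r) * (1 - r) + (1 - r) * r * (1 - r) := by
            noncomm_ring
        _ = r - 1 := by rw [h2, h3, mul_sub (1 - r), h3]; simp
    intro z hz
    rw [← neg_pos, ← neg_one_mul]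
    refine this z ?_
    convert hz using 2
    simp only [mul_add (1 - r), add_mul _ _ (1 - r), mul_smul_comm, smul_mul_assoc, hJ2]
    push_cast
    module

/-- The spectral conditions can be relaxed to closed half planes if `A` has no spectrum on the
imaginary axis. -/
theorem of_nonneg (hA : ∀ z ∈ spectrum ℂ A, z.re ≠ 0) (h1 : rᴴ = r) (h2 : r * r = r)
    (h3 : r * A * r = A * r) (h4 : ∀ z ∈ spectrum ℂ (r * A * r + (1 - r)), 0 ≤ z.re)
    (h5 : ∀ z ∈ spectrum ℂ ((1 - r) * A * (1 - r) - r), z.re ≤ 0) :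
    IsDichotomyProjection A r := by
  refine ⟨h1, h2, h3, fun z hz => (h4 z hz).lt_of_ne' fun h0 => ?_,
    fun z hz => (h5 z hz).lt_of_ne fun h0 => ?_⟩
  · obtain ⟨X, hX, h⟩ := exists_mul_eq_smul_of_mem_spectrum hz
    have hz1 : z ≠ 1 := by rintro rfl; simp at h0
    exact hA z (mem_spectrum_of_mul_eq_smul hX (mul_eq_self_of_compression_mul h2 h3 hz1 h).2) h0
  · obtain ⟨X, hX, h⟩ := exists_mul_eq_smul_of_mem_spectrum' hz
    rw [compl_mul_mul_compl h3] at h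
    have hY : X * r = 0 := by
      have h9 : X * ((1 - r) * A - r) * r = - (X * r) := by
        calc X * ((1 - r) * A - r) * r
            = X * (A * r - r * A * r) - X * (r * r) := by noncomm_ring
          _ = _ := by rw [h3, h2]; simp
      rw [h, smul_mul_assoc] at h9
      have h10 : (z + 1) • (X * r) = 0 := by rw [add_smul, h9, one_smul, neg_add_cancel]
      refine (smul_eq_zero.1 h10).resolve_left fun hz1 => ?_
      rw [eq_neg_of_add_eq_zero_left hz1] at h0
      simp at h0
    refine hA z (mem_spectrum_of_mul_eq_smul' hX ?_) h0
    rw [← h, mul_sub, hY, sub_zero, ← mul_assoc, mul_sub, hY, mul_one, sub_zero]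

theorem exists_of_re_ne_zero (hA : ∀ z ∈ spectrum ℂ A, z.re ≠ 0) :
    ∃ r, IsDichotomyProjection A r := by
  classical
  set p : ℂ[X] := ((A.charpoly.roots.filter (0 < ·.re)).map (X - C ·)).prod with hp
  set q : ℂ[X] := ((A.charpoly.roots.filter (¬ 0 < ·.re)).map (X - C ·)).prod with hq
  have hpq : p * q = A.charpoly := by
    rw [hp, hq, ← Multiset.prod_add, ← Multiset.map_add, Multiset.filter_add_not]
    exact ((IsAlgClosed.splits _).eq_prod_roots_of_monic A.charpoly_monic).symm
  have hp0 : ∀ z, p.eval z = 0 → 0 < z.re := by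
    intro z hz
    have hz' : z ∈ p.roots := (mem_roots (monic_multiset_prod_of_monic _ _
      fun a _ => monic_X_sub_C a).ne_zero).2 hz
    rw [hp, roots_multiset_prod_X_sub_C] at hz'
    exact (Multiset.mem_filter.1 hz').2
  have hq0 : ∀ z, q.eval z = 0 → z.re < 0 := by
    intro z hz
    have hz' : z ∈ q.roots := (mem_roots (monic_multiset_prod_of_monic _ _
      fun a _ => monic_X_sub_C a).ne_zero).2 hz
    rw [hq, roots_multiset_prod_X_sub_C, Multiset.mem_filter] at hz'
    exact (not_lt.1 hz'.2).lt_of_ne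
      (hA z (mem_spectrum_iff_isRoot_charpoly.2 (isRoot_of_mem_roots hz'.1)))
  obtain ⟨a, b, hab⟩ : IsCoprime p q := by
    rw [isCoprime_iff_aeval_ne_zero_of_isAlgClosed (k := ℂ) ℂ]
    intro z
    by_contra! hz
    rw [coe_aeval_eq_eval] at hz
    exact lt_asymm (hp0 z hz.1) (hq0 z hz.2)
  set P : Matrix n n ℂ := aeval A (b * q) with hP
  have hP1 : 1 - P = aeval A (a * p) := by
    rw [hP, ← map_one (aeval (R := ℂ) A), ← hab, ← map_sub, add_sub_cancel_right]
  have hpP : aeval A p * P = 0 := by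
    rw [hP, ← map_mul, show p * (b * q) = b * (p * q) by ring, hpq, map_mul,
      aeval_self_charpoly, mul_zero]
  have hqP : aeval A q * (1 - P) = 0 := by
    rw [hP1, ← map_mul, show q * (a * p) = a * (p * q) by ring, hpq, map_mul,
      aeval_self_charpoly, mul_zero]
  have hPP : P * P = P := by
    have : P * (1 - P) = 0 := by
      rw [hP1, hP, ← map_mul, show b * q * (a * p) = b * a * (p * q) by ring, hpq, map_mul,
        aeval_self_charpoly, mul_zero]
    rwa [mul_sub, mul_one, sub_eq_zero, eq_comm] at this
  have hAP : A * P = P * A := mul_aeval_eq_aeval_mul rfl _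
  obtain ⟨r, h1, h2, hPr, hrP⟩ := exists_orthogonalProjection_of_isIdempotentElem hPP
  have h3 : r * A * r = A * r := by
    calc r * A * r = r * (A * P) * r := by rw [mul_assoc, mul_assoc, mul_assoc A, hPr]
      _ = A * P * r := by rw [hAP, ← mul_assoc, hrP]
      _ = A * r := by rw [mul_assoc, hPr]
  have h9 : r * (1 - r) = 0 := by rw [mul_sub, mul_one, h2, sub_self]
  refine ⟨r, h1, h2, h3, fun z hz => ?_, fun z hz => ?_⟩
  · obtain ⟨X, hX, h⟩ := exists_mul_eq_smul_of_mem_spectrum hz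
    by_contra! h0
    have hz1 : z ≠ 1 := by
      rintro rfl
      rw [Complex.one_re] at h0
      linarith
    obtain ⟨hrX, h⟩ := mul_eq_self_of_compression_mul h2 h3 hz1 h
    have hPX : P * X = X := by rw [← hrX, ← mul_assoc, hPr]
    have h11 := aeval_mul_eq_eval_smul h p
    rw [← hPX, ← mul_assoc, hpP, zero_mul, hPX, eq_comm] at h11
    exact h0.not_gt (hp0 z ((smul_eq_zero.1 h11).resolve_right hX))
  · obtain ⟨X, hX, h⟩ := exists_mul_eq_smul_of_mem_spectrum hz
    by_contra! h0
    rw [compl_mul_mul_compl h3] at h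
    have hY : r * X = 0 := by
      have h10 : r * (((1 - r) * A - r) * X) = -(r * X) := by
        calc r * (((1 - r) * A - r) * X) = r * (1 - r) * A * X - r * r * X := by noncomm_ring
          _ = _ := by rw [h9, h2]; simp
      rw [h, mul_smul_comm] at h10
      have h11 : (z + 1) • (r * X) = 0 := by rw [add_smul, h10, one_smul, neg_add_cancel]
      refine (smul_eq_zero.1 h11).resolve_left fun hz1 => ?_
      rw [eq_neg_of_add_eq_zero_left hz1, Complex.neg_re, Complex.one_re] at h0
      linarith
    have h12 : (1 - P) * (1 - r) = 1 - P := by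
      rw [mul_sub, mul_one, sub_eq_self, sub_mul, one_mul, hPr, sub_self]
    have hc : A * (1 - P) = (1 - P) * A := by rw [mul_sub, sub_mul, hAP, mul_one, one_mul]
    have hU : A * ((1 - P) * X) = z • ((1 - P) * X) := by
      rw [← mul_smul_comm, ← h, sub_mul _ r, hY, sub_zero, ← mul_assoc, hc, mul_assoc (1 - r),
        ← mul_assoc (1 - P) (1 - r), h12, mul_assoc]
    have h13 := aeval_mul_eq_eval_smul hU q
    rw [← mul_assoc, hqP, zero_mul, eq_comm] at h13
    have h14 := (smul_eq_zero.1 h13).resolve_left fun hz1 => h0.not_gt (hq0 z hz1)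
    rw [sub_mul, one_mul, sub_eq_zero] at h14
    apply hX
    rw [h14, ← hrP, mul_assoc, ← h14, hY]

theorem norm_apply_le_one (hr : IsDichotomyProjection A r) (i j : n) : ‖r i j‖ ≤ 1 := by
  have h : ∀ i, ∑ k, ‖r i k‖ ^ 2 = (r i i).re := by
    intro i
    have h1 := congrFun (congrFun hr.mul_self i) i
    rw [mul_apply] at h1
    rw [← h1, Complex.re_sum]
    refine Finset.sum_congr rfl fun k _ => ?_
    have h2 : r k i = star (r i k) := (congrFun (congrFun hr.conjTranspose_eq k) i).symm
    rw [h2, Complex.star_def, Complex.mul_conj, Complex.ofReal_re, Complex.normSq_eq_norm_sq]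
  have h1 : ∀ k, ‖r i k‖ ^ 2 ≤ (r i i).re := fun k =>
    h i ▸ Finset.single_le_sum (f := fun k => ‖r i k‖ ^ 2) (fun _ _ => sq_nonneg _)
      (Finset.mem_univ k)
  have h2 := h1 i
  have h3 := h1 j
  have h4 := Complex.re_le_norm (r i i)
  have h5 : ‖r i i‖ ≤ 1 := by nlinarith
  exact (sq_le_one_iff₀ (norm_nonneg _)).1 (h3.trans (h4.trans h5))

end IsDichotomyProjection

theorem pow_card_le_norm_eval_charpoly {M : Matrix n n ℂ} {z : ℂ} {d : ℝ} (hd : 0 ≤ d)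
    (h : ∀ w ∈ spectrum ℂ M, d ≤ ‖z - w‖) :
    d ^ Fintype.card n ≤ ‖M.charpoly.eval z‖ := by
  have key : ∀ s : Multiset ℂ, (∀ w ∈ s, d ≤ ‖z - w‖) →
      d ^ s.card ≤ ‖(s.map (z - ·)).prod‖ := by
    intro s
    induction s using Multiset.induction with
    | empty => simp
    | cons a s ih =>
      intro hs
      rw [Multiset.card_cons, Multiset.map_cons, Multiset.prod_cons, norm_mul, pow_succ']
      exact mul_le_mul (hs a (Multiset.mem_cons_self a s))
        (ih fun w hw => hs w (Multiset.mem_cons_of_mem hw)) (by positivity) (norm_nonneg _)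
  have hs := IsAlgClosed.splits M.charpoly
  rw [hs.eval_eq_prod_roots_of_monic M.charpoly_monic, ← M.charpoly_natDegree_eq_dim,
    hs.natDegree_eq_card_roots]
  exact key _ fun w hw => h w (mem_spectrum_iff_isRoot_charpoly.2 (isRoot_of_mem_roots hw))

theorem isClosed_setOf_spectrum_re_nonneg :
    IsClosed {M : Matrix n n ℂ | ∀ z ∈ spectrum ℂ M, 0 ≤ z.re} := by
  have : {M : Matrix n n ℂ | ∀ z ∈ spectrum ℂ M, 0 ≤ z.re} =
      ⋂ z : {z : ℂ // z.re < 0},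
        {M | (-z.1.re) ^ Fintype.card n ≤ ‖(scalar n z.1 - M).det‖} := by
    ext M
    simp only [Set.mem_ofPred_eq, Set.mem_iInter, ← eval_charpoly]
    constructor
    · rintro h ⟨z, hz⟩
      refine pow_card_le_norm_eval_charpoly (neg_nonneg.2 hz.le) fun w hw => ?_
      have h1 := Complex.abs_re_le_norm (z - w)
      rw [Complex.sub_re] at h1
      linarith [neg_abs_le (z.re - w.re), h w hw]
    · intro h z hz
      by_contra! h0
      have h1 := h ⟨z, h0⟩
      rw [mem_spectrum_iff_isRoot_charpoly.1 hz, norm_zero] at h1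
      exact (pow_pos (neg_pos.2 h0) _).not_ge h1
  rw [this]
  exact isClosed_iInter fun z => isClosed_le continuous_const (by fun_prop)

theorem isClosed_setOf_spectrum_re_nonpos :
    IsClosed {M : Matrix n n ℂ | ∀ z ∈ spectrum ℂ M, z.re ≤ 0} := by
  convert (isClosed_setOf_spectrum_re_nonneg (n := n)).preimage continuous_neg using 1
  ext M
  simp only [Set.mem_ofPred_eq, Set.mem_preimage, ← spectrum.neg_eq, Set.mem_neg]
  exact ⟨fun h z hz => by simpa using h _ hz, fun h z hz => by simpa using h (-z) (by simpa)⟩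

/-- A map into a compact set with closed graph is continuous. -/
theorem _root_.continuous_of_isClosed_graph_of_mem_isCompact {X Y : Type*} [TopologicalSpace X]
    [TopologicalSpace Y] {f : X → Y} {K : Set Y} (hK : IsCompact K) (hf : ∀ x, f x ∈ K)
    (h : IsClosed {p : X × Y | f p.1 = p.2}) : Continuous f := by
  have : CompactSpace K := isCompact_iff_compactSpace.1 hK
  refine continuous_iff_isClosed.2 fun s hs => ?_
  have hg : IsClosed ({p : X × K | f p.1 = p.2} ∩ {p | (p.2 : Y) ∈ s}) :=
    (h.preimage (continuous_id.prodMap continuous_subtype_val)).inter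
      (hs.preimage (continuous_subtype_val.comp continuous_snd))
  convert isClosedMap_fst_of_compactSpace _ hg using 1
  ext x
  constructor
  · intro hx
    exact ⟨(x, ⟨f x, hf x⟩), ⟨rfl, hx⟩, rfl⟩
  · rintro ⟨⟨y, k⟩, ⟨h1, h2⟩, rfl⟩
    simp only [Set.mem_ofPred_eq] at h1 h2
    rwa [Set.mem_preimage, h1]

theorem IsDichotomyProjection.continuous {X : Type*} [TopologicalSpace X] {A r : X → Matrix n n ℂ}
    (hA : Continuous A) (hr : ∀ x, IsDichotomyProjection (A x) (r x)) : Continuous r := by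
  refine continuous_of_isClosed_graph_of_mem_isCompact
    (K := Set.univ.pi fun _ => Set.univ.pi fun _ => Metric.closedBall (0 : ℂ) 1)
    (isCompact_univ_pi fun _ => isCompact_univ_pi fun _ => isCompact_closedBall _ _)
    (fun x i _ j _ => mem_closedBall_zero_iff.2 ((hr x).norm_apply_le_one i j)) ?_
  have : {p : X × Matrix n n ℂ | r p.1 = p.2} =
      {p | p.2ᴴ = p.2} ∩ {p | p.2 * p.2 = p.2} ∩ {p | p.2 * A p.1 * p.2 = A p.1 * p.2} ∩
      {p | ∀ z ∈ spectrum ℂ (p.2 * A p.1 * p.2 + (1 - p.2)), 0 ≤ z.re} ∩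
      {p | ∀ z ∈ spectrum ℂ ((1 - p.2) * A p.1 * (1 - p.2) - p.2), z.re ≤ 0} := by
    ext ⟨x, s⟩
    constructor
    · intro (hs : r x = s)
      subst hs
      exact ⟨⟨⟨⟨(hr x).conjTranspose_eq, (hr x).mul_self⟩, (hr x).invariant⟩,
        fun z hz => ((hr x).re_pos z hz).le⟩, fun z hz => ((hr x).re_neg z hz).le⟩
    · rintro ⟨⟨⟨⟨h1, h2⟩, h3⟩, h4⟩, h5⟩
      exact (hr x).unique (.of_nonneg (fun z hz => (hr x).re_ne_zero hz) h1 h2 h3 h4 h5)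
  rw [this]
  refine ((((isClosed_eq ?_ ?_).inter (isClosed_eq ?_ ?_)).inter (isClosed_eq ?_ ?_)).inter
    (isClosed_setOf_spectrum_re_nonneg.preimage ?_)).inter
    (isClosed_setOf_spectrum_re_nonpos.preimage ?_)
  all_goals fun_prop

end Matrix

/-- **Flattening for imaginary line gaps.** A continuous family of matrices over a
compact Hausdorff space all of whose eigenvalues have nonzero imaginary part can be
deformed, through families with an imaginary line gap, to a family of anti-Hermitian
matrices squaring to `-1`. -/
theorem imaginary_line_gap_flattening
    {X : Type*} [TopologicalSpace X] [CompactSpace X] [T2Space X] (n : ℕ)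
    (H : X → Matrix (Fin n) (Fin n) ℂ) (hcont : Continuous H)
    (hgap : ∀ x, ∀ z ∈ spectrum ℂ (H x), z.im ≠ 0) :
    ∃ F : X × unitInterval → Matrix (Fin n) (Fin n) ℂ,
      Continuous F ∧
      (∀ x, F (x, 0) = H x) ∧
      (∀ p : X × unitInterval, ∀ z ∈ spectrum ℂ (F p), z.im ≠ 0) ∧
      (∀ x, (F (x, 1))ᴴ = -(F (x, 1)) ∧ (F (x, 1)) ^ 2 = -1) := by
  have hgap' : ∀ x, ∀ z ∈ spectrum ℂ (-Complex.I • H x), z.re ≠ 0 := by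
    intro x z hz
    obtain ⟨X, hX, h⟩ := exists_mul_eq_smul_of_mem_spectrum hz
    have h' : H x * X = (Complex.I * z) • X := by
      rw [← smul_smul, ← h, smul_mul_assoc, smul_smul]
      simp
    simpa using hgap x _ (mem_spectrum_of_mul_eq_smul hX h')
  choose r hr using fun x => IsDichotomyProjection.exists_of_re_ne_zero (hgap' x)
  have hrc : Continuous r := IsDichotomyProjection.continuous (by fun_prop) hr
  refine ⟨fun p => Complex.I • (((1 - p.2 : ℝ) : ℂ) • (-Complex.I • H p.1) +
    ((p.2 : ℝ) : ℂ) • (2 * r p.1 - 1)), ?_, fun x => ?_, ?_, fun x => ⟨?_, ?_⟩⟩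
  · fun_prop
  · simp [smul_smul]
  · rintro ⟨x, t⟩ z hz
    obtain ⟨X, hX, h⟩ := exists_mul_eq_smul_of_mem_spectrum hz
    have h' := congrArg (-Complex.I • ·) h
    simp only [smul_mul_assoc, smul_smul, neg_mul, Complex.I_mul_I, neg_neg, one_smul] at h'
    have := ((hr x).segment t.2.1 t.2.2).re_ne_zero
      (mem_spectrum_of_mul_eq_smul hX (z := -(Complex.I * z)) ?_)
    · simpa using this
    · rw [← h']
      rw [smul_smul]
  · have h2 : (2 : Matrix (Fin n) (Fin n) ℂ) = (2 : ℂ) • 1 := by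
      rw [← Algebra.algebraMap_eq_smul_one, map_ofNat]
    simp [h2, conjTranspose_smul, (hr x).conjTranspose_eq]
  · have h2 : (2 * r x - 1) ^ 2 = 1 := by
      calc (2 * r x - 1) ^ 2 = 4 * (r x * r x) - 4 * r x + 1 := by noncomm_ring
        _ = 1 := by rw [(hr x).mul_self]; noncomm_ring
    simp [smul_pow, h2]
end

section
/- Let ε, v, Γ, Γ₀ ∈ ℝ with Γ ≠ 0, and for ω ∈ ℝ define the 2×2 complex matrix H_eff(ω) = (v²/(ω − ε + iΓ))·P_z + (v²/(ω + ε + iΓ))·P_x − iΓ₀·1, where P_z = [[1,0],[0,0]] and P_x = (1/2)·[[1,1],[1,1]]. Let U = (1/√2)·[[1,1],[1,−1]]. Then: (a) U is unitary and Hermitian with U² = 1; (b) for every ω ∈ ℝ, H_eff(ω) is a symmetric matrix, i.e. H_eff(ω)ᵀ = H_eff(ω); and (c) for every ω ∈ ℝ, U · conj(H_eff(ω)) · U = −H_eff(−ω), where conj denotes entrywise complex conjugation. -/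
open Matrix

/-- The effective Hamiltonian of the paper's three-orbital model:
`H_eff(ω) = v²/(ω - ε + iΓ) · P_z + v²/(ω + ε + iΓ) · P_x - iΓ₀ · 1`, with
`P_z = |↑⟩⟨↑|` and `P_x = |→⟩⟨→|`. -/
noncomputable def Heff (ε v Γ Γ₀ : ℝ) (ω : ℝ) : Matrix (Fin 2) (Fin 2) ℂ :=
  (((v : ℂ) ^ 2) / ((ω : ℂ) - (ε : ℂ) + Complex.I * (Γ : ℂ))) • !![1, 0; 0, 0] +
  (((v : ℂ) ^ 2) / ((ω : ℂ) + (ε : ℂ) + Complex.I * (Γ : ℂ))) •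
    ((1 / 2 : ℂ) • !![1, 1; 1, 1]) -
  (Complex.I * (Γ₀ : ℂ)) • 1

theorem inv_sqrt_two_smul_mul_mul_smul {n : Type*} [Fintype n] (S A : Matrix n n ℂ) :
    ((1 / (Real.sqrt 2 : ℂ)) • S) * A * ((1 / (Real.sqrt 2 : ℂ)) • S) =
      (1 / 2 : ℂ) • (S * A * S) := by
  have h : (1 / (Real.sqrt 2 : ℂ)) * (1 / (Real.sqrt 2 : ℂ)) = 1 / 2 := by
    rw [div_mul_div_comm, ← Complex.ofReal_mul, Real.mul_self_sqrt zero_le_two]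
    norm_num
  rw [smul_mul_assoc, smul_mul_assoc, mul_smul_comm, smul_smul, h]

theorem inv_sqrt_two_smul_isHermitian :
    ((1 / (Real.sqrt 2 : ℂ)) • !![1, 1; 1, -1] : Matrix (Fin 2) (Fin 2) ℂ).IsHermitian := by
  ext i j
  fin_cases i <;> fin_cases j <;> simp

theorem inv_sqrt_two_smul_mul_self :
    ((1 / (Real.sqrt 2 : ℂ)) • !![1, 1; 1, -1] : Matrix (Fin 2) (Fin 2) ℂ) *
      ((1 / (Real.sqrt 2 : ℂ)) • !![1, 1; 1, -1]) = 1 := by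
  have h := inv_sqrt_two_smul_mul_mul_smul !![1, 1; 1, -1] (1 : Matrix (Fin 2) (Fin 2) ℂ)
  rw [mul_one, mul_one] at h
  rw [h]
  ext i j
  fin_cases i <;> fin_cases j <;> norm_num [Matrix.mul_apply, Fin.sum_univ_two]

theorem Heff_map_conj (ε v Γ Γ₀ ω : ℝ) :
    (Heff ε v Γ Γ₀ ω).map (starRingEnd ℂ) =
      -((((v : ℂ) ^ 2) / (((-ω : ℝ) : ℂ) + (ε : ℂ) + Complex.I * (Γ : ℂ))) • !![1, 0; 0, 0] +
        (((v : ℂ) ^ 2) / (((-ω : ℝ) : ℂ) - (ε : ℂ) + Complex.I * (Γ : ℂ))) •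
          ((1 / 2 : ℂ) • !![1, 1; 1, 1]) -
        (Complex.I * (Γ₀ : ℂ)) • 1) := by
  have h₁ : ((-ω : ℝ) : ℂ) + ε + Complex.I * Γ = -((ω : ℂ) - ε + -(Complex.I * Γ)) := by
    push_cast; ring
  have h₂ : ((-ω : ℝ) : ℂ) - ε + Complex.I * Γ = -((ω : ℂ) + ε + -(Complex.I * Γ)) := by
    push_cast; ring
  rw [h₁, h₂, div_neg, div_neg]
  ext i j
  fin_cases i <;> fin_cases j <;> simp [Heff, map_ofNat] <;> ring

/-- The three-orbital model belongs to class `BDI†`: with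
`U = (σ₁ + σ₃)/√2 = (1/√2)·[[1,1],[1,-1]]`, (a) `U` is unitary and Hermitian with
`U² = 1`; (b) `H_eff(ω)` is symmetric (TRS† with `U_{TRS†} = 1`); and
(c) `U conj(H_eff(ω)) U = -H_eff(-ω)` (PHS†). -/
theorem Heff_symmetries (ε v Γ Γ₀ : ℝ) (hΓ : Γ ≠ 0) :
    (((1 / (Real.sqrt 2 : ℂ)) • !![1, 1; 1, -1] : Matrix (Fin 2) (Fin 2) ℂ)ᴴ *
        ((1 / (Real.sqrt 2 : ℂ)) • !![1, 1; 1, -1]) = 1 ∧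
      (((1 / (Real.sqrt 2 : ℂ)) • !![1, 1; 1, -1] : Matrix (Fin 2) (Fin 2) ℂ)).IsHermitian ∧
      (((1 / (Real.sqrt 2 : ℂ)) • !![1, 1; 1, -1] : Matrix (Fin 2) (Fin 2) ℂ)) ^ 2 = 1) ∧
    (∀ ω : ℝ, (Heff ε v Γ Γ₀ ω)ᵀ = Heff ε v Γ Γ₀ ω) ∧
    (∀ ω : ℝ,
      ((1 / (Real.sqrt 2 : ℂ)) • !![1, 1; 1, -1] : Matrix (Fin 2) (Fin 2) ℂ) *
          (Heff ε v Γ Γ₀ ω).map (starRingEnd ℂ) *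
          ((1 / (Real.sqrt 2 : ℂ)) • !![1, 1; 1, -1]) =
        -(Heff ε v Γ Γ₀ (-ω))) := by
  refine ⟨⟨?_, inv_sqrt_two_smul_isHermitian, ?_⟩, fun ω => ?_, fun ω => ?_⟩
  · rw [inv_sqrt_two_smul_isHermitian.eq, inv_sqrt_two_smul_mul_self]
  · rw [pow_two, inv_sqrt_two_smul_mul_self]
  · ext i j
    fin_cases i <;> fin_cases j <;> simp [Heff]
  · rw [inv_sqrt_two_smul_mul_mul_smul, Heff_map_conj, Heff, Matrix.one_fin_two]
    generalize (v : ℂ) ^ 2 / (((-ω : ℝ) : ℂ) + ε + Complex.I * Γ) = a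
    generalize (v : ℂ) ^ 2 / (((-ω : ℝ) : ℂ) - ε + Complex.I * Γ) = b
    ext i j
    fin_cases i <;> fin_cases j <;> simp <;> ring
end

section
/- Let ε = 1, v = 1, Γ = 1/10, Γ₀ = −1/5, and for ω ∈ ℝ define H_eff(ω) = (v²/(ω − ε + iΓ))·P_z + (v²/(ω + ε + iΓ))·P_x − iΓ₀·1 ∈ M_2(ℂ), where P_z = [[1,0],[0,0]] and P_x = (1/2)·[[1,1],[1,1]]. Then det H_eff(ω) ≠ 0 for every ω ∈ ℝ; in particular H_eff(ω) is invertible for all real ω (the model has a point gap). -/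
open Matrix

/-- The determinant of `Heff` with the denominators of its two poles cleared. -/
theorem Heff_det_mul (ε v Γ Γ₀ ω : ℝ)
    (hA : (ω : ℂ) - ε + Complex.I * Γ ≠ 0) (hB : (ω : ℂ) + ε + Complex.I * Γ ≠ 0) :
    (Heff ε v Γ Γ₀ ω).det *
        (((ω : ℂ) - ε + Complex.I * Γ) * ((ω : ℂ) + ε + Complex.I * Γ)) =
      (v : ℂ) ^ 4 / 2 - Complex.I * Γ₀ * (v : ℂ) ^ 2 * (2 * (ω + Complex.I * Γ)) -
        (Γ₀ : ℂ) ^ 2 * ((ω + Complex.I * Γ) ^ 2 - (ε : ℂ) ^ 2) := by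
  have key : ∀ A B : ℂ, A ≠ 0 → B ≠ 0 →
      (((v : ℂ) ^ 2 / A + (v : ℂ) ^ 2 / B * 2⁻¹ - Complex.I * Γ₀) *
          ((v : ℂ) ^ 2 / B * 2⁻¹ - Complex.I * Γ₀) -
          (v : ℂ) ^ 2 / B * 2⁻¹ * ((v : ℂ) ^ 2 / B * 2⁻¹)) * (A * B) =
        (v : ℂ) ^ 4 / 2 - Complex.I * Γ₀ * (v : ℂ) ^ 2 * (A + B) -
          (Γ₀ : ℂ) ^ 2 * (A * B) := by
    intro A B hA hB
    field_simp
    linear_combination (4 * A * B ^ 2 * (Γ₀ : ℂ) ^ 2) * Complex.I_sq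
  have hdet := key _ _ hA hB
  simp only [Heff, det_fin_two, Matrix.add_apply, Matrix.sub_apply, Matrix.smul_apply, of_apply,
    cons_val', cons_val_zero, cons_val_one, cons_val_fin_one, one_apply_eq, smul_eq_mul, mul_one,
    mul_zero, zero_add, sub_zero, one_div, ne_eq, zero_ne_one, one_ne_zero, not_false_eq_true,
    one_apply_ne]
  linear_combination hdet

/-- For the parameters `ε = 1`, `v = 1`, `Γ = 1/10`, `Γ₀ = -1/5` of Fig. 2 of the
paper, the effective Hamiltonian has a point gap: its determinant never vanishes,
so `H_eff(ω)` is invertible for every real `ω`. -/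
theorem Heff_point_gap :
    ∀ ω : ℝ, (Heff 1 1 (1 / 10) (-(1 / 5)) ω).det ≠ 0 ∧
      IsUnit (Heff 1 1 (1 / 10) (-(1 / 5)) ω) := by
  intro ω
  have hdet : (Heff 1 1 (1 / 10) (-(1 / 5)) ω).det ≠ 0 := by
    intro h0
    have h := Heff_det_mul 1 1 (1 / 10) (-(1 / 5)) ω
      (fun h => by simpa using congrArg Complex.im h)
      (fun h => by simpa using congrArg Complex.im h)
    rw [h0, zero_mul] at h
    have hre := congrArg Complex.re h
    have him := congrArg Complex.im h
    simp [pow_succ] at hre him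
    have hω : ω = 0 := by linarith
    subst hω
    norm_num at hre
  exact ⟨hdet, (isUnit_iff_isUnit_det _).2 (isUnit_iff_ne_zero.2 hdet)⟩
end

section
/- Let ε = 1, v = 1, Γ = 1/10, Γ₀ = −1/5, and for ω ∈ ℝ define H_eff(ω) = (v²/(ω − ε + iΓ))·P_z + (v²/(ω + ε + iΓ))·P_x − iΓ₀·1 ∈ M_2(ℂ), where P_z = [[1,0],[0,0]] and P_x = (1/2)·[[1,1],[1,1]]. Then there exist continuous functions r : ℝ → ℝ and θ : ℝ → ℝ with r(ω) > 0 and det H_eff(ω) = r(ω)·exp(iθ(ω)) for all ω ∈ ℝ, such that θ(ω) converges to finite limits θ₊ as ω → +∞ and θ₋ as ω → −∞, and θ₊ − θ₋ = 4π. That is, the winding number w = (1/2πi) ∫ dω ∂_ω ln det H_eff(ω) of the point-gapped effective Hamiltonian in the frequency direction equals 2. -/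
open Matrix Filter

theorem add_mul_I_eq_mul_exp_arctan {c : ℝ} (hc : 0 < c) (x : ℝ) :
    (c : ℂ) + x * Complex.I =
      ((c * √(1 + (x / c) ^ 2) : ℝ) : ℂ) *
        Complex.exp ((Real.arctan (x / c) : ℂ) * Complex.I) := by
  have h : √(1 + (x / c) ^ 2) ≠ 0 := (Real.sqrt_pos.2 (by positivity)).ne'
  rw [Complex.exp_mul_I, ← Complex.ofReal_cos, ← Complex.ofReal_sin, Real.cos_arctan,
    Real.sin_arctan]
  apply Complex.ext
  · simp only [Complex.add_re, Complex.mul_re, Complex.ofReal_re, Complex.ofReal_im,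
      Complex.I_re, Complex.I_im, Complex.add_im, Complex.mul_im]
    field_simp
    ring
  · simp only [Complex.add_re, Complex.mul_re, Complex.ofReal_re, Complex.ofReal_im,
      Complex.I_re, Complex.I_im, Complex.add_im, Complex.mul_im]
    field_simp
    ring

theorem tendsto_arctan_add_div_atTop {c : ℝ} (hc : 0 < c) (a : ℝ) :
    Tendsto (fun x : ℝ => Real.arctan ((x + a) / c)) atTop (nhds (Real.pi / 2)) :=
  (Real.tendsto_arctan_atTop.mono_right nhdsWithin_le_nhds).comp
    ((tendsto_atTop_add_const_right _ a tendsto_id).atTop_div_const hc)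

theorem tendsto_arctan_add_div_atBot {c : ℝ} (hc : 0 < c) (a : ℝ) :
    Tendsto (fun x : ℝ => Real.arctan ((x + a) / c)) atBot (nhds (-(Real.pi / 2))) :=
  (Real.tendsto_arctan_atBot.mono_right nhdsWithin_le_nhds).comp
    ((tendsto_atBot_add_const_right _ a tendsto_id).atBot_div_const hc)

/-- The determinant factors over its zeros `i c₁`, `i c₂`, both in the upper half-plane, and
its poles `±1 - i / 10`, both in the lower half-plane. -/
theorem Heff_det_eq_factored {c₁ c₂ : ℝ} (hsum : c₁ + c₂ = 49 / 5)
    (hprod : c₁ * c₂ = 1251 / 100) (ω : ℝ) :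
    (Heff 1 1 (1 / 10) (-(1 / 5)) ω).det =
      -((1 / 25 / (((1 / 10) ^ 2 + (ω + -1) ^ 2) * ((1 / 10) ^ 2 + (ω + 1) ^ 2)) : ℝ) : ℂ) *
        ((c₁ : ℂ) + (ω + 0 : ℝ) * Complex.I) * ((c₂ : ℂ) + (ω + 0 : ℝ) * Complex.I) *
        (((1 / 10 : ℝ) : ℂ) + (ω + -1 : ℝ) * Complex.I) *
        (((1 / 10 : ℝ) : ℂ) + (ω + 1 : ℝ) * Complex.I) := by
  have hI := Complex.I_sq
  have hnum : ((c₁ : ℂ) + ω * Complex.I) * ((c₂ : ℂ) + ω * Complex.I) =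
      1251 / 100 + 49 / 5 * ω * Complex.I - ω ^ 2 := by
    have hs : (c₁ : ℂ) + c₂ = 49 / 5 := by
      rw [← Complex.ofReal_add, hsum]
      norm_num
    have hp : (c₁ : ℂ) * c₂ = 1251 / 100 := by
      rw [← Complex.ofReal_mul, hprod]
      norm_num
    linear_combination hp + ω * Complex.I * hs + (ω : ℂ) ^ 2 * hI
  have hpole (x : ℝ) : ((x : ℂ) + Complex.I * (1 / 10))⁻¹ =
      ((((1 / 10) ^ 2 + x ^ 2 : ℝ) : ℂ))⁻¹ * (x - Complex.I * (1 / 10)) := by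
    have h₁ : (((1 / 10) ^ 2 + x ^ 2 : ℝ) : ℂ) ≠ 0 := by
      exact_mod_cast (by positivity : (1 / 10) ^ 2 + x ^ 2 ≠ (0 : ℝ))
    have h₂ : ((x : ℂ) + Complex.I * (1 / 10)) * (x - Complex.I * (1 / 10)) =
        (((1 / 10) ^ 2 + x ^ 2 : ℝ) : ℂ) := by
      push_cast
      linear_combination -(1 / 100 : ℂ) * hI
    refine inv_eq_of_mul_eq_one_right ?_
    rw [mul_left_comm, h₂, inv_mul_cancel₀ h₁]
  have hm := hpole (ω + -1)
  have hp := hpole (ω + 1)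
  have hAm : (((1 / 10) ^ 2 + (ω + -1) ^ 2 : ℝ) : ℂ) ≠ 0 := by
    exact_mod_cast (by positivity : (1 / 10) ^ 2 + (ω + -1) ^ 2 ≠ (0 : ℝ))
  have hAp : (((1 / 10) ^ 2 + (ω + 1) ^ 2 : ℝ) : ℂ) ≠ 0 := by
    exact_mod_cast (by positivity : (1 / 10) ^ 2 + (ω + 1) ^ 2 ≠ (0 : ℝ))
  rw [add_zero, mul_assoc (-_ : ℂ), hnum]
  have hdet : (Heff 1 1 (1 / 10) (-(1 / 5)) ω).det =
      (((ω + -1 : ℝ) : ℂ) + Complex.I * (1 / 10))⁻¹ *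
        (((ω + 1 : ℝ) : ℂ) + Complex.I * (1 / 10))⁻¹ *
        (1 / 2 + Complex.I / 5 * (2 * (ω + Complex.I * (1 / 10))) -
          ((ω + Complex.I * (1 / 10)) ^ 2 - 1) / 25) := by
    have h₁ : ((ω + -1 : ℝ) : ℂ) + Complex.I * (1 / 10) ≠ 0 := fun h => by
      have := congrArg Complex.im h
      norm_num at this
    have h₂ : ((ω + 1 : ℝ) : ℂ) + Complex.I * (1 / 10) ≠ 0 := fun h => by
      have := congrArg Complex.im h
      norm_num at this
    have e₁ : (ω : ℂ) - ((1 : ℝ) : ℂ) + Complex.I * ((1 / 10 : ℝ) : ℂ) =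
        ((ω + -1 : ℝ) : ℂ) + Complex.I * (1 / 10) := by push_cast; ring
    have e₂ : (ω : ℂ) + ((1 : ℝ) : ℂ) + Complex.I * ((1 / 10 : ℝ) : ℂ) =
        ((ω + 1 : ℝ) : ℂ) + Complex.I * (1 / 10) := by push_cast; ring
    rw [Heff, e₁, e₂, Matrix.det_fin_two]
    simp only [Matrix.add_apply, Matrix.sub_apply, Matrix.smul_apply, Matrix.of_apply,
      Matrix.cons_val', Matrix.cons_val_zero, Matrix.cons_val_one, Matrix.cons_val_fin_one,
      Matrix.one_apply, smul_eq_mul, Fin.isValue, if_true, zero_ne_one, one_ne_zero, if_false]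
    generalize hz₁ : ((ω + -1 : ℝ) : ℂ) + Complex.I * (1 / 10) = z₁ at *
    generalize hz₂ : ((ω + 1 : ℝ) : ℂ) + Complex.I * (1 / 10) = z₂ at *
    have w₁ : (ω : ℂ) + Complex.I * (1 / 10) = z₁ + 1 := by rw [← hz₁]; push_cast; ring
    have w₂ : z₂ = z₁ + 2 := by rw [← hz₁, ← hz₂]; push_cast; ring
    rw [w₁]
    push_cast
    field_simp
    subst w₂
    ring_nf
    simp only [hI]
    ring
  rw [hdet, hm, hp]
  push_cast at hAm hAp ⊢
  field_simp
  ring_nf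
  have hI3 : Complex.I ^ 3 = -Complex.I := by rw [pow_succ, hI]; ring
  have hI4 : Complex.I ^ 4 = 1 := by rw [pow_succ, hI3]; linear_combination -hI
  simp only [hI, hI3, hI4]
  ring

/-- For the parameters `ε = 1`, `v = 1`, `Γ = 1/10`, `Γ₀ = -1/5` of Fig. 2 of the
paper, the winding number of `det H_eff(ω)` in the frequency direction equals `2`:
there is a continuous polar decomposition `det H_eff(ω) = r(ω) e^{iθ(ω)}` with
`r > 0`, the phase `θ` has finite limits `θ₊`, `θ₋` at `ω → ±∞`, and
`θ₊ - θ₋ = 4π`. -/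
theorem Heff_frequency_winding_number_eq_two :
    ∃ (r θ : ℝ → ℝ),
      Continuous r ∧ Continuous θ ∧
      (∀ ω : ℝ, 0 < r ω) ∧
      (∀ ω : ℝ, (Heff 1 1 (1 / 10) (-(1 / 5)) ω).det =
        (r ω : ℂ) * Complex.exp ((θ ω : ℂ) * Complex.I)) ∧
      ∃ θp θm : ℝ,
        Tendsto θ atTop (nhds θp) ∧
        Tendsto θ atBot (nhds θm) ∧
        θp - θm = 4 * Real.pi := by
  set s := √(23 / 2 : ℝ)
  have hsq : s ^ 2 = 23 / 2 := Real.sq_sqrt (by norm_num)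
  have hs0 : 0 ≤ s := Real.sqrt_nonneg _
  have hc₁ : 0 < 49 / 10 - s := by nlinarith
  have hc₂ : 0 < 49 / 10 + s := by linarith
  have hΓ : (0 : ℝ) < 1 / 10 := by norm_num
  set c₁ := 49 / 10 - s with hc₁_def
  set c₂ := 49 / 10 + s with hc₂_def
  let ρ : ℝ → ℝ → ℝ := fun c x => c * √(1 + (x / c) ^ 2)
  have hρ {c : ℝ} (hc : 0 < c) (x : ℝ) : 0 < ρ c x :=
    mul_pos hc (Real.sqrt_pos.2 (by positivity))
  have hden (ω : ℝ) :
      0 < ((1 / 10) ^ 2 + (ω + -1) ^ 2) * ((1 / 10) ^ 2 + (ω + 1) ^ 2) := by positivity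
  refine ⟨fun ω => 1 / 25 / (((1 / 10) ^ 2 + (ω + -1) ^ 2) * ((1 / 10) ^ 2 + (ω + 1) ^ 2)) *
      ρ c₁ (ω + 0) * ρ c₂ (ω + 0) * ρ (1 / 10) (ω + -1) * ρ (1 / 10) (ω + 1),
    fun ω => Real.arctan ((ω + 0) / c₁) + Real.arctan ((ω + 0) / c₂) +
      Real.arctan ((ω + -1) / (1 / 10)) + Real.arctan ((ω + 1) / (1 / 10)) + Real.pi,
    ?_, ?_, fun ω => ?_, fun ω => ?_, _, _,
    ((((tendsto_arctan_add_div_atTop hc₁ 0).add (tendsto_arctan_add_div_atTop hc₂ 0)).add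
      (tendsto_arctan_add_div_atTop hΓ (-1))).add
      (tendsto_arctan_add_div_atTop hΓ 1)).add_const Real.pi,
    ((((tendsto_arctan_add_div_atBot hc₁ 0).add (tendsto_arctan_add_div_atBot hc₂ 0)).add
      (tendsto_arctan_add_div_atBot hΓ (-1))).add
      (tendsto_arctan_add_div_atBot hΓ 1)).add_const Real.pi, by ring⟩
  · have := fun ω => (hden ω).ne'
    fun_prop (disch := assumption)
  · fun_prop
  · have := hden ω
    have := hρ hc₁ (ω + 0)
    have := hρ hc₂ (ω + 0)
    have := hρ hΓ (ω + -1)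
    have := hρ hΓ (ω + 1)
    positivity
  · rw [Heff_det_eq_factored (c₁ := c₁) (c₂ := c₂) (by rw [hc₁_def, hc₂_def]; ring)
        (by rw [hc₁_def, hc₂_def]; linear_combination -hsq),
      add_mul_I_eq_mul_exp_arctan hc₁, add_mul_I_eq_mul_exp_arctan hc₂,
      add_mul_I_eq_mul_exp_arctan hΓ, add_mul_I_eq_mul_exp_arctan hΓ]
    simp only [Complex.ofReal_add (_ + _ : ℝ), Complex.ofReal_add (Real.arctan _),
      add_mul (_ + _ : ℂ), add_mul (Complex.ofReal (Real.arctan _)),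
      Complex.exp_add, Complex.exp_pi_mul_I, Complex.ofReal_mul, ρ]
    ring
end
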